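/- Let n : ℕ and let s₁ s₂ : Fin (2^n) → ℂ be unit vectors stabilized by maximal Pauli stabilizer groups: for i = 1, 2 let Sᵢ be a finite commutative subgroup of the invertible 2^n × 2^n complex matrices whose every element has the form ε • P(x,z) with ε ∈ {1,-1}, with -1 ∉ Sᵢ, |Sᵢ| = 2^n, and g.mulVec sᵢ = sᵢ for all g ∈ Sᵢ. If ⟪s₁, s₂⟫ = 0, then there exists g ∈ S₁ with g.mulVec s₂ = -s₂. -/

import Mathlib

open Matrix

noncomputable def PauliX : Matrix (Fin 2) (Fin 2) ℂ := !![0, 1; 1, 0]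
noncomputable def PauliZ : Matrix (Fin 2) (Fin 2) ℂ := !![1, 0; 0, -1]

/-- The `n`-qubit Pauli string `P(x,z)`, the `n`-fold Kronecker product over `i` of
`X^(x i) * Z^(z i)`, viewed as a `2^n × 2^n` complex matrix. -/
noncomputable def pauliString (n : ℕ) (x z : Fin n → ZMod 2) :
    Matrix (Fin (2 ^ n)) (Fin (2 ^ n)) ℂ :=
  Matrix.reindex finFunctionFinEquiv finFunctionFinEquiv
    (Matrix.of fun a b : Fin n → Fin 2 =>
      ∏ i, (PauliX ^ (x i).val * PauliZ ^ (z i).val) (a i) (b i))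

/-- `S` is a maximal Pauli stabilizer group of the `n`-qubit state `s`: a commutative
group of signed Pauli strings of order `2^n`, not containing `-1`, whose every element
fixes `s`. -/
def IsMaximalStabilizerOf (n : ℕ)
    (S : Subgroup (Matrix.GeneralLinearGroup (Fin (2 ^ n)) ℂ))
    (s : Fin (2 ^ n) → ℂ) : Prop :=
  (∀ g ∈ S, ∀ h ∈ S, g * h = h * g) ∧
  (∀ g ∈ S, ∃ (ε : ℂ) (x z : Fin n → ZMod 2),
      (ε = 1 ∨ ε = -1) ∧
        (g : Matrix (Fin (2 ^ n)) (Fin (2 ^ n)) ℂ) = ε • pauliString n x z) ∧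
  (∀ g ∈ S, (g : Matrix (Fin (2 ^ n)) (Fin (2 ^ n)) ℂ) ≠ -1) ∧
  Nat.card S = 2 ^ n ∧
  (∀ g ∈ S, Matrix.mulVec (g : Matrix (Fin (2 ^ n)) (Fin (2 ^ n)) ℂ) s = s)

/-- The Kronecker product of a family of square matrices. -/
def piKronecker {ι κ : Type*} [Fintype ι] (A : ι → Matrix κ κ ℂ) :
    Matrix (ι → κ) (ι → κ) ℂ :=
  Matrix.of fun a b => ∏ i, A i (a i) (b i)

section PiKronecker

variable {ι κ : Type*} [Fintype ι] (A B : ι → Matrix κ κ ℂ)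

theorem piKronecker_mul [DecidableEq ι] [Fintype κ] :
    piKronecker A * piKronecker B = piKronecker fun i => A i * B i := by
  ext a b
  simp only [piKronecker, Matrix.mul_apply, Matrix.of_apply, ← Finset.prod_mul_distrib]
  rw [Finset.prod_univ_sum, Fintype.piFinset_univ]

theorem piKronecker_conjTranspose :
    (piKronecker A)ᴴ = piKronecker fun i => (A i)ᴴ := by
  ext a b
  simp [piKronecker, Matrix.conjTranspose_apply]

theorem piKronecker_smul (c : ι → ℂ) :
    (piKronecker fun i => c i • A i) = (∏ i, c i) • piKronecker A := by
  ext a b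
  simp [piKronecker, Finset.prod_mul_distrib]

theorem piKronecker_one [DecidableEq κ] :
    (piKronecker fun _ : ι => (1 : Matrix κ κ ℂ)) = 1 := by
  ext a b
  simp [piKronecker, Matrix.one_apply, Fintype.prod_ite_zero, funext_iff]

theorem piKronecker_trace [DecidableEq ι] [Fintype κ] :
    (piKronecker A).trace = ∏ i, (A i).trace := by
  simp only [piKronecker, Matrix.trace, Matrix.diag, Matrix.of_apply]
  rw [Finset.prod_univ_sum, Fintype.piFinset_univ]

end PiKronecker

section Qubit

variable (x z x' z' : ZMod 2)

/-- The single-qubit Pauli matrix `X^x * Z^z`. -/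
noncomputable def qubitPauli : Matrix (Fin 2) (Fin 2) ℂ :=
  PauliX ^ x.val * PauliZ ^ z.val

theorem zmod_two_eq_zero_or_one : x = 0 ∨ x = 1 := by
  revert x
  decide

theorem qubitPauli_commute_up_to_sign :
    ∃ c : ℂ, (c = 1 ∨ c = -1) ∧
      qubitPauli x z * qubitPauli x' z' = c • (qubitPauli x' z' * qubitPauli x z) := by
  rcases zmod_two_eq_zero_or_one x with rfl | rfl <;>
  rcases zmod_two_eq_zero_or_one z with rfl | rfl <;>
  rcases zmod_two_eq_zero_or_one x' with rfl | rfl <;>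
  rcases zmod_two_eq_zero_or_one z' with rfl | rfl <;>
  first
  | refine ⟨1, Or.inl rfl, ?_⟩; simp [qubitPauli, ZMod.val_one, PauliX, PauliZ]; done
  | refine ⟨-1, Or.inr rfl, ?_⟩; simp [qubitPauli, ZMod.val_one, PauliX, PauliZ]

theorem qubitPauli_mul_self :
    ∃ c : ℂ, (c = 1 ∨ c = -1) ∧ qubitPauli x z * qubitPauli x z = c • 1 := by
  rcases zmod_two_eq_zero_or_one x with rfl | rfl <;>
  rcases zmod_two_eq_zero_or_one z with rfl | rfl <;>
  first
  | refine ⟨1, Or.inl rfl, ?_⟩; simp [qubitPauli, ZMod.val_one, PauliX, PauliZ, Matrix.one_fin_two]; done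
  | refine ⟨-1, Or.inr rfl, ?_⟩; simp [qubitPauli, ZMod.val_one, PauliX, PauliZ, Matrix.one_fin_two]

theorem qubitPauli_conjTranspose_mul_self : (qubitPauli x z)ᴴ * qubitPauli x z = 1 := by
  rcases zmod_two_eq_zero_or_one x with rfl | rfl <;>
  rcases zmod_two_eq_zero_or_one z with rfl | rfl <;>
  ext i j <;> fin_cases i <;> fin_cases j <;>
  simp [qubitPauli, ZMod.val_one, PauliX, PauliZ, Matrix.mul_apply]

theorem qubitPauli_trace (h : x ≠ 0 ∨ z ≠ 0) : (qubitPauli x z).trace = 0 := by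
  rcases zmod_two_eq_zero_or_one x with rfl | rfl <;>
  rcases zmod_two_eq_zero_or_one z with rfl | rfl <;>
  simp_all [qubitPauli, ZMod.val_one, PauliX, PauliZ, Matrix.trace_fin_two]

end Qubit

theorem prod_eq_one_or_neg_one {ι : Type*} [Fintype ι] {c : ι → ℂ}
    (hc : ∀ i, c i = 1 ∨ c i = -1) : (∏ i, c i) = 1 ∨ (∏ i, c i) = -1 := by
  refine Finset.prod_induction c (fun y => y = 1 ∨ y = -1) ?_ (Or.inl rfl) fun i _ => hc i
  rintro a b (rfl | rfl) (rfl | rfl) <;> simp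

section PauliString

variable {n : ℕ} (x z x' z' : Fin n → ZMod 2)

theorem pauliString_eq : pauliString n x z =
    Matrix.reindexAlgEquiv ℂ ℂ finFunctionFinEquiv
      (piKronecker fun i => qubitPauli (x i) (z i)) := rfl

theorem pauliString_commute_up_to_sign :
    ∃ c : ℂ, (c = 1 ∨ c = -1) ∧
      pauliString n x z * pauliString n x' z' =
        c • (pauliString n x' z' * pauliString n x z) := by
  choose c hc h using fun i => qubitPauli_commute_up_to_sign (x i) (z i) (x' i) (z' i)
  refine ⟨∏ i, c i, prod_eq_one_or_neg_one hc, ?_⟩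
  simp only [pauliString_eq, ← map_mul, ← map_smul, piKronecker_mul, ← piKronecker_smul, h]

theorem pauliString_mul_self :
    ∃ c : ℂ, (c = 1 ∨ c = -1) ∧ pauliString n x z * pauliString n x z = c • 1 := by
  choose c hc h using fun i => qubitPauli_mul_self (x i) (z i)
  refine ⟨∏ i, c i, prod_eq_one_or_neg_one hc, ?_⟩
  simp only [pauliString_eq, ← map_mul, piKronecker_mul, h]
  rw [piKronecker_smul, piKronecker_one, map_smul, map_one]

theorem pauliString_conjTranspose_mul_self :
    (pauliString n x z)ᴴ * pauliString n x z = 1 := by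
  have h : (pauliString n x z)ᴴ = Matrix.reindexAlgEquiv ℂ ℂ finFunctionFinEquiv
      (piKronecker fun i => qubitPauli (x i) (z i))ᴴ := rfl
  rw [h, pauliString_eq, ← map_mul, piKronecker_conjTranspose, piKronecker_mul]
  simp only [qubitPauli_conjTranspose_mul_self]
  rw [piKronecker_one, map_one]

theorem pauliString_zero : pauliString n 0 0 = 1 := by
  have h : qubitPauli 0 0 = 1 := by simp [qubitPauli]
  simp only [pauliString_eq, Pi.zero_apply, h]
  rw [piKronecker_one, map_one]

theorem pauliString_trace (h : x ≠ 0 ∨ z ≠ 0) : (pauliString n x z).trace = 0 := by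
  have ht : (pauliString n x z).trace =
      (piKronecker fun i => qubitPauli (x i) (z i)).trace := by
    rw [pauliString_eq]
    exact Equiv.sum_comp finFunctionFinEquiv.symm fun a =>
      (piKronecker fun i => qubitPauli (x i) (z i)) a a
  obtain ⟨i, hi⟩ : ∃ i, x i ≠ 0 ∨ z i ≠ 0 := by
    rcases h with h | h <;> obtain ⟨i, hi⟩ := Function.ne_iff.mp h
    exacts [⟨i, Or.inl hi⟩, ⟨i, Or.inr hi⟩]
  rw [ht, piKronecker_trace]
  exact Finset.prod_eq_zero (Finset.mem_univ i) (qubitPauli_trace _ _ hi)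

end PauliString

namespace IsMaximalStabilizerOf

variable {n : ℕ} {S : Subgroup (Matrix.GeneralLinearGroup (Fin (2 ^ n)) ℂ)}
  {s : Fin (2 ^ n) → ℂ}

theorem mul_self (hS : IsMaximalStabilizerOf n S s)
    {g : Matrix.GeneralLinearGroup (Fin (2 ^ n)) ℂ} (hg : g ∈ S) :
    (g : Matrix (Fin (2 ^ n)) (Fin (2 ^ n)) ℂ) * g = 1 := by
  obtain ⟨ε, x, z, hε, h⟩ := hS.2.1 g hg
  obtain ⟨c, hc, hm⟩ := pauliString_mul_self x z
  have hgg : (g : Matrix (Fin (2 ^ n)) (Fin (2 ^ n)) ℂ) * g = c • 1 := by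
    rw [h, smul_mul_smul_comm, hm]
    rcases hε with rfl | rfl <;> simp
  rcases hc with rfl | rfl
  · simpa using hgg
  · refine absurd ?_ (hS.2.2.1 (g * g) (S.mul_mem hg hg))
    simpa using hgg

theorem isHermitian (hS : IsMaximalStabilizerOf n S s)
    {g : Matrix.GeneralLinearGroup (Fin (2 ^ n)) ℂ} (hg : g ∈ S) :
    (g : Matrix (Fin (2 ^ n)) (Fin (2 ^ n)) ℂ).IsHermitian := by
  obtain ⟨ε, x, z, hε, h⟩ := hS.2.1 g hg
  have hu : (g : Matrix (Fin (2 ^ n)) (Fin (2 ^ n)) ℂ)ᴴ * g = 1 := by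
    rw [h, Matrix.conjTranspose_smul, smul_mul_smul_comm, pauliString_conjTranspose_mul_self]
    rcases hε with rfl | rfl <;> simp
  exact left_inv_eq_right_inv hu (hS.mul_self hg)

theorem trace_eq_zero (hS : IsMaximalStabilizerOf n S s)
    {g : Matrix.GeneralLinearGroup (Fin (2 ^ n)) ℂ} (hg : g ∈ S) (hg1 : g ≠ 1) :
    (g : Matrix (Fin (2 ^ n)) (Fin (2 ^ n)) ℂ).trace = 0 := by
  obtain ⟨ε, x, z, hε, h⟩ := hS.2.1 g hg
  by_cases hxz : x ≠ 0 ∨ z ≠ 0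
  · rw [h, Matrix.trace_smul, pauliString_trace x z hxz, smul_zero]
  · push Not at hxz
    obtain ⟨rfl, rfl⟩ := hxz
    rw [pauliString_zero] at h
    rcases hε with rfl | rfl
    · exact absurd (Units.ext (by simpa using h)) hg1
    · exact absurd (by simpa using h) (hS.2.2.1 g hg)

open scoped ComplexOrder in
/-- The sum of the stabilizer group is a multiple of the projection onto the state. -/
theorem sum_eq [Fintype S] (hS : IsMaximalStabilizerOf n S s) (hs : star s ⬝ᵥ s = 1) :
    ∑ g : S, ((g : Matrix.GeneralLinearGroup (Fin (2 ^ n)) ℂ) :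
      Matrix (Fin (2 ^ n)) (Fin (2 ^ n)) ℂ) = (2 ^ n : ℂ) • Matrix.vecMulVec s (star s) := by
  classical
  set T := ∑ g : S, ((g : Matrix.GeneralLinearGroup (Fin (2 ^ n)) ℂ) :
      Matrix (Fin (2 ^ n)) (Fin (2 ^ n)) ℂ) with hT
  set R := Matrix.vecMulVec s (star s) with hR
  have hcard : (Fintype.card S : ℂ) = 2 ^ n := by
    rw [← Nat.card_eq_fintype_card, hS.2.2.2.1]
    norm_num
  have hmul (g : S) : ((g : Matrix.GeneralLinearGroup (Fin (2 ^ n)) ℂ) :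
      Matrix (Fin (2 ^ n)) (Fin (2 ^ n)) ℂ) * T = T := by
    rw [hT, Finset.mul_sum]
    exact Equiv.sum_comp (Equiv.mulLeft g) fun h : S =>
      ((h : Matrix.GeneralLinearGroup (Fin (2 ^ n)) ℂ) : Matrix (Fin (2 ^ n)) (Fin (2 ^ n)) ℂ)
  have hTT : T * T = (2 ^ n : ℂ) • T := by
    conv_lhs => rw [hT, Finset.sum_mul]
    rw [Finset.sum_congr rfl fun g _ => hmul g, Finset.sum_const, Finset.card_univ,
      ← Nat.cast_smul_eq_nsmul ℂ, hcard]
  have hTH : Tᴴ = T := by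
    rw [hT, Matrix.conjTranspose_sum]
    exact Finset.sum_congr rfl fun g _ => hS.isHermitian g.2
  have hRH : Rᴴ = R := by
    rw [hR, Matrix.conjTranspose_vecMulVec, star_star]
  have hTs : T *ᵥ s = (2 ^ n : ℂ) • s := by
    rw [hT, Matrix.sum_mulVec, Finset.sum_congr rfl fun g _ => hS.2.2.2.2 _ (Subtype.prop g),
      Finset.sum_const, Finset.card_univ, ← Nat.cast_smul_eq_nsmul ℂ, hcard]
  have hTR : T * R = (2 ^ n : ℂ) • R := by
    rw [hR, Matrix.mul_vecMulVec, hTs, Matrix.smul_vecMulVec]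
  have hRT : R * T = (2 ^ n : ℂ) • R := by
    have h := congrArg Matrix.conjTranspose hTR
    simpa [Matrix.conjTranspose_mul, hTH, hRH] using h
  have hRR : R * R = R := by
    rw [hR, Matrix.vecMulVec_mul_vecMulVec, hs, one_smul]
  have htr : T.trace = 2 ^ n := by
    rw [hT, Matrix.trace_sum, Finset.sum_eq_single (1 : S)]
    · simp
    · exact fun g _ hg => hS.trace_eq_zero g.2 fun h => hg (Subtype.ext h)
    · simp
  have htrR : R.trace = 1 := by
    rw [hR, Matrix.trace_vecMulVec, dotProduct_comm, hs]
  refine sub_eq_zero.mp (Matrix.trace_mul_conjTranspose_self_eq_zero_iff.mp ?_)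
  have hQH : (T - (2 ^ n : ℂ) • R)ᴴ = T - (2 ^ n : ℂ) • R := by
    simp [hTH, hRH]
  have hQQ : (T - (2 ^ n : ℂ) • R) * (T - (2 ^ n : ℂ) • R) =
      (2 ^ n : ℂ) • (T - (2 ^ n : ℂ) • R) := by
    simp only [sub_mul, mul_sub, smul_mul_assoc, mul_smul_comm, hTT, hTR, hRT, hRR, smul_sub]
    abel
  rw [hQH, hQQ, Matrix.trace_smul, Matrix.trace_sub, Matrix.trace_smul, htr, htrR]
  simp

theorem eq_smul_of_fixed (hS : IsMaximalStabilizerOf n S s) (hs : star s ⬝ᵥ s = 1)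
    {v : Fin (2 ^ n) → ℂ}
    (hv : ∀ g ∈ S, (g : Matrix (Fin (2 ^ n)) (Fin (2 ^ n)) ℂ) *ᵥ v = v) :
    v = (star s ⬝ᵥ v) • s := by
  have : Finite S := Nat.finite_of_card_ne_zero (by rw [hS.2.2.2.1]; positivity)
  have := Fintype.ofFinite S
  have h := congrArg (· *ᵥ v) (hS.sum_eq hs)
  simp only [Matrix.sum_mulVec, Matrix.smul_mulVec, Matrix.vecMulVec_mulVec, op_smul_eq_smul] at h
  rw [Finset.sum_congr rfl fun g _ => hv _ (Subtype.prop g), Finset.sum_const, Finset.card_univ,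
    ← Nat.card_eq_fintype_card, hS.2.2.2.1, ← Nat.cast_smul_eq_nsmul ℂ] at h
  push_cast at h
  simpa using smul_right_injective _ (pow_ne_zero n (two_ne_zero (α := ℂ))) h

/-- A Pauli involution either has vanishing expectation in a stabilizer state or has the state as an
eigenvector. -/
theorem expectation_eq_zero_or_mulVec_eq (hS : IsMaximalStabilizerOf n S s)
    (hs : star s ⬝ᵥ s = 1) {M : Matrix (Fin (2 ^ n)) (Fin (2 ^ n)) ℂ} {ε : ℂ}
    {x z : Fin n → ZMod 2} (hM : M = ε • pauliString n x z) (hMM : M * M = 1) :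
    star s ⬝ᵥ M *ᵥ s = 0 ∨ M *ᵥ s = s ∨ M *ᵥ s = -s := by
  have hcomm : ∀ h ∈ S, (h : Matrix (Fin (2 ^ n)) (Fin (2 ^ n)) ℂ) * M = M * h ∨
      (h : Matrix (Fin (2 ^ n)) (Fin (2 ^ n)) ℂ) * M = -(M * h) := by
    intro h hh
    obtain ⟨δ, x', z', -, hδ⟩ := hS.2.1 h hh
    obtain ⟨c, hc, hP⟩ := pauliString_commute_up_to_sign x' z' x z
    have hc' : (h : Matrix (Fin (2 ^ n)) (Fin (2 ^ n)) ℂ) * M = c • (M * h) := by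
      rw [hδ, hM, smul_mul_smul_comm, smul_mul_smul_comm, hP, smul_smul, smul_smul]
      congr 1
      ring
    rcases hc with rfl | rfl
    · exact Or.inl (by simpa using hc')
    · exact Or.inr (by simpa using hc')
  by_cases hall : ∀ h ∈ S, (h : Matrix (Fin (2 ^ n)) (Fin (2 ^ n)) ℂ) * M = M * h
  · right
    have hfix := hS.eq_smul_of_fixed hs (v := M *ᵥ s) fun h hh => by
      rw [Matrix.mulVec_mulVec, hall h hh, ← Matrix.mulVec_mulVec, hS.2.2.2.2 h hh]
    set c := star s ⬝ᵥ M *ᵥ s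
    have hcc : (c * c) • s = s := by
      rw [mul_smul, ← hfix, ← Matrix.mulVec_smul, ← hfix, Matrix.mulVec_mulVec, hMM,
        Matrix.one_mulVec]
    have hc : c * c = 1 := by
      simpa [dotProduct_smul, hs] using congrArg (star s ⬝ᵥ ·) hcc
    rcases mul_self_eq_one_iff.mp hc with h | h
    · exact Or.inl (by rw [hfix, h, one_smul])
    · exact Or.inr (by rw [hfix, h, neg_one_smul])
  · left
    push Not at hall
    obtain ⟨h, hh, hne⟩ := hall
    have hanti := (hcomm h hh).resolve_left hne
    have hbra : star s ᵥ* (h : Matrix (Fin (2 ^ n)) (Fin (2 ^ n)) ℂ) = star s := by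
      have := congrArg star (hS.2.2.2.2 h hh)
      rwa [Matrix.star_mulVec, (hS.isHermitian hh).eq] at this
    have hneg : star s ⬝ᵥ M *ᵥ s = -(star s ⬝ᵥ M *ᵥ s) := by
      conv_lhs => rw [← hbra]
      rw [← Matrix.dotProduct_mulVec, Matrix.mulVec_mulVec, hanti, Matrix.neg_mulVec,
        ← Matrix.mulVec_mulVec, hS.2.2.2.2 h hh, dotProduct_neg]
    exact self_eq_neg.mp hneg

end IsMaximalStabilizerOf

/-- Two orthogonal stabilizer states share a common stabilizer element with opposite
eigenvalues: some `g` in the stabilizer group of `s₁` satisfies `g s₂ = -s₂`. -/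
theorem stmt_10 (n : ℕ) (s₁ s₂ : Fin (2 ^ n) → ℂ)
    (h₁ : star s₁ ⬝ᵥ s₁ = 1) (h₂ : star s₂ ⬝ᵥ s₂ = 1)
    (S₁ S₂ : Subgroup (Matrix.GeneralLinearGroup (Fin (2 ^ n)) ℂ))
    (hS₁ : IsMaximalStabilizerOf n S₁ s₁) (hS₂ : IsMaximalStabilizerOf n S₂ s₂)
    (horth : star s₁ ⬝ᵥ s₂ = 0) :
    ∃ g ∈ S₁, Matrix.mulVec (g : Matrix (Fin (2 ^ n)) (Fin (2 ^ n)) ℂ) s₂ = -s₂ := by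
  by_contra! hno
  have : Finite S₁ := Nat.finite_of_card_ne_zero (by rw [hS₁.2.2.2.1]; positivity)
  have := Fintype.ofFinite S₁
  have hsum : ∑ g : S₁, star s₂ ⬝ᵥ ((g : Matrix.GeneralLinearGroup (Fin (2 ^ n)) ℂ) :
      Matrix (Fin (2 ^ n)) (Fin (2 ^ n)) ℂ) *ᵥ s₂ = 0 := by
    rw [← dotProduct_sum, ← Matrix.sum_mulVec, hS₁.sum_eq h₁, Matrix.smul_mulVec,
      Matrix.vecMulVec_mulVec, horth]
    simp
  have hnonneg (g : S₁) : 0 ≤ (star s₂ ⬝ᵥ ((g : Matrix.GeneralLinearGroup (Fin (2 ^ n)) ℂ) :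
      Matrix (Fin (2 ^ n)) (Fin (2 ^ n)) ℂ) *ᵥ s₂).re := by
    obtain ⟨ε, x, z, -, hg⟩ := hS₁.2.1 g g.2
    rcases hS₂.expectation_eq_zero_or_mulVec_eq h₂ hg (hS₁.mul_self g.2) with h | h | h
    · simp [h]
    · simp [h, h₂]
    · exact absurd h (hno g g.2)
  have hre := congrArg Complex.re hsum
  rw [Complex.re_sum, Complex.zero_re,
    Finset.sum_eq_zero_iff_of_nonneg fun g _ => hnonneg g] at hre
  simpa [h₂] using hre 1 (Finset.mem_univ _)
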